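/- There exist an absolute constant C ≥ 1 and a natural number t such that the following holds. Suppose α : G⁵ → 𝔽₂ is a multilinear form such that prank(α + α∘π) ≤ r for every permutation π ∈ Sym₅. Then there exists a symmetric multilinear form α' : G⁵ → 𝔽₂ such that prank(α + α') ≤ exp^{(t)}(C·r^C). -/

import Mathlib

open Finset

/-- `β : (Fin k → V) → ZMod 2` is a multilinear form in the variables indexed by `S`:
it depends only on the coordinates in `S` and is additive (hence `𝔽₂`-linear) in each of
those coordinates. -/
def MultilinearOn {V : Type*} [AddCommGroup V] [Module (ZMod 2) V] (k : ℕ)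
    (S : Finset (Fin k)) (β : (Fin k → V) → ZMod 2) : Prop :=
  (∀ x y : Fin k → V, (∀ i ∈ S, x i = y i) → β x = β y) ∧
  (∀ i ∈ S, ∀ (x : Fin k → V) (u v : V),
    β (Function.update x i (u + v)) = β (Function.update x i u) + β (Function.update x i v))

/-- A multilinear form in all `k` variables. -/
def IsMultilinear {V : Type*} [AddCommGroup V] [Module (ZMod 2) V] (k : ℕ)
    (α : (Fin k → V) → ZMod 2) : Prop :=
  MultilinearOn k Finset.univ α

/-- `α`, a multilinear form in the variables indexed by `S`, admits a partition-rank
decomposition with `m` terms. -/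
def PrankDecompOn {V : Type*} [AddCommGroup V] [Module (ZMod 2) V] (k : ℕ)
    (S : Finset (Fin k)) (m : ℕ) (α : (Fin k → V) → ZMod 2) : Prop :=
  ∃ (I : Fin m → Finset (Fin k)) (β γ : Fin m → ((Fin k → V) → ZMod 2)),
    (∀ i, I i ⊆ S) ∧ (∀ i, I i ≠ ∅) ∧ (∀ i, I i ≠ S) ∧
    (∀ i, MultilinearOn k (I i) (β i)) ∧
    (∀ i, MultilinearOn k (S \ I i) (γ i)) ∧
    (∀ x, α x = ∑ i, β i x * γ i x)

/-- The partition rank of a multilinear form in the variables indexed by `S`. -/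
noncomputable def prankOn {V : Type*} [AddCommGroup V] [Module (ZMod 2) V] (k : ℕ)
    (S : Finset (Fin k)) (α : (Fin k → V) → ZMod 2) : ℕ :=
  sInf {m | PrankDecompOn k S m α}

/-- The partition rank of a multilinear form in `k` variables. -/
noncomputable def prank {V : Type*} [AddCommGroup V] [Module (ZMod 2) V] (k : ℕ)
    (α : (Fin k → V) → ZMod 2) : ℕ :=
  prankOn k Finset.univ α

/-- `α ∘ π`: the form `(x₁, …, x_k) ↦ α(x_{π⁻¹(1)}, …, x_{π⁻¹(k)})`. -/
def permForm {V : Type*} (k : ℕ) (π : Equiv.Perm (Fin k))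
    (α : (Fin k → V) → ZMod 2) : (Fin k → V) → ZMod 2 :=
  fun x => α (fun i => x (π.symm i))

/-- `α` is symmetric in its first `m` variables (0-indexed: coordinates `< m`). -/
def SymmetricInFirst {V : Type*} (k m : ℕ) (α : (Fin k → V) → ZMod 2) : Prop :=
  ∀ i j : Fin k, (i : ℕ) < m → (j : ℕ) < m → permForm k (Equiv.swap i j) α = α

/-- `α` is symmetric in all of its variables. -/
def SymmetricForm {V : Type*} (k : ℕ) (α : (Fin k → V) → ZMod 2) : Prop :=
  ∀ π : Equiv.Perm (Fin k), permForm k π α = α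

/-- `σ` is strongly symmetric: it is symmetric, and the form
`(x, y₃, …, y_k) ↦ σ(x, x, y₃, …, y_k)` is also symmetric.  (Given the symmetry of `σ`,
the latter is equivalent to being allowed to swap the doubled variable with the third
variable, which is how it is stated here.) -/
def StronglySymmetric {V : Type*} (k : ℕ) (σ : (Fin k → V) → ZMod 2) : Prop :=
  SymmetricForm k σ ∧
  ∀ (u v : V) (z : Fin k → V),
    σ (fun i => if (i : ℕ) = 0 ∨ (i : ℕ) = 1 then u else if (i : ℕ) = 2 then v else z i) =
    σ (fun i => if (i : ℕ) = 0 ∨ (i : ℕ) = 1 then v else if (i : ℕ) = 2 then u else z i)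

section Permutation

variable {V : Type*} {k : ℕ}

theorem update_comp_perm (π : Equiv.Perm (Fin k)) (x : Fin k → V) (i : Fin k) (u : V) :
    (fun j => Function.update x i u (π.symm j)) =
      Function.update (fun j => x (π.symm j)) (π i) u := by
  funext j
  by_cases h : j = π i
  · subst h; simp
  · have : π.symm j ≠ i := fun h' => h (by rw [← h']; simp)
    simp [h, this]

theorem permForm_permForm (g h : Equiv.Perm (Fin k)) (f : (Fin k → V) → ZMod 2) :
    permForm k g (permForm k h f) = permForm k (h * g) f := rfl

theorem permForm_add (g : Equiv.Perm (Fin k)) (f f' : (Fin k → V) → ZMod 2) :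
    permForm k g (f + f') = permForm k g f + permForm k g f' := rfl

theorem permForm_sum {ι : Type*} (s : Finset ι) (g : Equiv.Perm (Fin k))
    (f : ι → (Fin k → V) → ZMod 2) :
    permForm k g (∑ i ∈ s, f i) = ∑ i ∈ s, permForm k g (f i) := by
  funext x
  simp [permForm, Finset.sum_apply]

theorem form_add_self (f : (Fin k → V) → ZMod 2) : f + f = 0 := by
  funext x
  exact CharTwo.add_self_eq_zero _

end Permutation

section Multilinear

variable {V : Type*} [AddCommGroup V] [Module (ZMod 2) V] {k : ℕ}

/-- Apply the same map to every argument. -/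
def pull (p : V →ₗ[ZMod 2] V) (f : (Fin k → V) → ZMod 2) : (Fin k → V) → ZMod 2 :=
  fun x => f (fun i => p (x i))

theorem MultilinearOn.zero (S : Finset (Fin k)) :
    MultilinearOn k S (0 : (Fin k → V) → ZMod 2) :=
  ⟨fun _ _ _ => rfl, fun _ _ _ _ _ => by simp⟩

theorem MultilinearOn.add {S : Finset (Fin k)} {f g : (Fin k → V) → ZMod 2}
    (hf : MultilinearOn k S f) (hg : MultilinearOn k S g) : MultilinearOn k S (f + g) := by
  refine ⟨fun x y h => ?_, fun i hi x u v => ?_⟩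
  · simp [hf.1 x y h, hg.1 x y h]
  · simp only [Pi.add_apply, hf.2 i hi, hg.2 i hi]
    ring

theorem MultilinearOn.sum {ι : Type*} (s : Finset ι) {S : Finset (Fin k)}
    {f : ι → (Fin k → V) → ZMod 2} (hf : ∀ i ∈ s, MultilinearOn k S (f i)) :
    MultilinearOn k S (∑ i ∈ s, f i) := by
  classical
  induction s using Finset.induction_on with
  | empty => exact MultilinearOn.zero S
  | insert a s ha ih =>
    rw [Finset.sum_insert ha]
    exact (hf a (by simp)).add (ih fun i hi => hf i (by simp [hi]))

theorem MultilinearOn.update_of_notMem {S : Finset (Fin k)} {f : (Fin k → V) → ZMod 2}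
    (hf : MultilinearOn k S f) {i : Fin k} (hi : i ∉ S) (x : Fin k → V) (u : V) :
    f (Function.update x i u) = f x :=
  hf.1 _ _ fun j hj => by
    rw [Function.update_of_ne]
    rintro rfl
    exact hi hj

theorem MultilinearOn.mul {S T : Finset (Fin k)} {β γ : (Fin k → V) → ZMod 2}
    (hβ : MultilinearOn k S β) (hγ : MultilinearOn k T γ) (hST : Disjoint S T) :
    MultilinearOn k (S ∪ T) (β * γ) := by
  refine ⟨fun x y h => ?_, fun i hi x u v => ?_⟩
  · simp only [Pi.mul_apply]
    rw [hβ.1 x y fun i hi => h i (by simp [hi]), hγ.1 x y fun i hi => h i (by simp [hi])]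
  · simp only [Pi.mul_apply]
    rcases Finset.mem_union.1 hi with h | h
    · have h' : i ∉ T := Finset.disjoint_left.1 hST h
      simp only [hβ.2 i h, hγ.update_of_notMem h']
      ring
    · have h' : i ∉ S := Finset.disjoint_right.1 hST h
      simp only [hγ.2 i h, hβ.update_of_notMem h']
      ring

/-- Apply a linear map to every argument, depending on its index. -/
def pullFam (q : Fin k → V →ₗ[ZMod 2] V) (f : (Fin k → V) → ZMod 2) : (Fin k → V) → ZMod 2 :=
  fun x => f (fun i => q i (x i))

theorem pullFam_update (q : Fin k → V →ₗ[ZMod 2] V) (x : Fin k → V) (i : Fin k) (u : V) :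
    (fun j => q j (Function.update x i u j)) =
      Function.update (fun j => q j (x j)) i (q i u) := by
  funext j
  by_cases h : j = i
  · subst h; simp
  · simp [h]

theorem MultilinearOn.pullFam {S : Finset (Fin k)} {f : (Fin k → V) → ZMod 2}
    (hf : MultilinearOn k S f) (q : Fin k → V →ₗ[ZMod 2] V) :
    MultilinearOn k S (pullFam q f) := by
  refine ⟨fun x y h => hf.1 _ _ fun i hi => by rw [h i hi], fun i hi x u v => ?_⟩
  simp only [_root_.pullFam, pullFam_update, map_add, hf.2 i hi]

theorem MultilinearOn.pull {S : Finset (Fin k)} {f : (Fin k → V) → ZMod 2}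
    (hf : MultilinearOn k S f) (p : V →ₗ[ZMod 2] V) : MultilinearOn k S (pull p f) :=
  hf.pullFam fun _ => p

theorem MultilinearOn.contract {S : Finset (Fin k)} {f : (Fin k → V) → ZMod 2}
    (hf : MultilinearOn k S f) (i : Fin k) (e : V) :
    MultilinearOn k (S \ {i}) (fun x => f (Function.update x i e)) := by
  refine ⟨fun x y h => hf.1 _ _ fun j hj => ?_, fun j hj x u v => ?_⟩
  · by_cases hji : j = i
    · subst hji; simp
    · simp [hji, h j (by simp [hj, hji])]
  · simp only [Finset.mem_sdiff, Finset.mem_singleton] at hj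
    simp only [Function.update_comm hj.2]
    exact hf.2 j hj.1 _ _ _

theorem MultilinearOn.permForm {S : Finset (Fin k)} {f : (Fin k → V) → ZMod 2}
    (π : Equiv.Perm (Fin k)) (hf : MultilinearOn k (S.map π.toEmbedding) f) :
    MultilinearOn k S (permForm k π f) := by
  refine ⟨fun x y h => hf.1 _ _ fun i hi => ?_, fun i hi x u v => ?_⟩
  · obtain ⟨j, hj, rfl⟩ := Finset.mem_map.1 hi
    simpa using h j hj
  · simp only [_root_.permForm, update_comp_perm]
    exact hf.2 (π i) (Finset.mem_map_of_mem _ hi) _ _ _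

/-- `f` is a sum of `m` products of a form in the variables of `I` and one in the other
variables. -/
def SplitRank (I : Finset (Fin k)) (m : ℕ) (f : (Fin k → V) → ZMod 2) : Prop :=
  ∃ β γ : Fin m → ((Fin k → V) → ZMod 2),
    (∀ i, MultilinearOn k I (β i)) ∧ (∀ i, MultilinearOn k (univ \ I) (γ i)) ∧
      f = ∑ i, β i * γ i

theorem SplitRank.add {I : Finset (Fin k)} {m m' : ℕ} {f f' : (Fin k → V) → ZMod 2}
    (h : SplitRank I m f) (h' : SplitRank I m' f') : SplitRank I (m + m') (f + f') := by
  obtain ⟨β, γ, hβ, hγ, rfl⟩ := h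
  obtain ⟨β', γ', hβ', hγ', rfl⟩ := h'
  refine ⟨Fin.append β β', Fin.append γ γ', ?_, ?_, ?_⟩
  · intro i
    refine Fin.addCases (fun i => ?_) (fun i => ?_) i <;> simp [hβ, hβ']
  · intro i
    refine Fin.addCases (fun i => ?_) (fun i => ?_) i <;> simp [hγ, hγ']
  · simp [Fin.sum_univ_add]

theorem SplitRank.pull {I : Finset (Fin k)} {m : ℕ} {f : (Fin k → V) → ZMod 2}
    (h : SplitRank I m f) (p : V →ₗ[ZMod 2] V) : SplitRank I m (pull p f) := by
  obtain ⟨β, γ, hβ, hγ, rfl⟩ := h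
  refine ⟨fun i => _root_.pull p (β i), fun i => _root_.pull p (γ i), fun i => (hβ i).pull p,
    fun i => (hγ i).pull p, ?_⟩
  funext x
  simp [_root_.pull, Finset.sum_apply]

theorem SplitRank.permForm {I : Finset (Fin k)} {m : ℕ} {f : (Fin k → V) → ZMod 2}
    (π : Equiv.Perm (Fin k)) (h : SplitRank (I.map π.toEmbedding) m f) :
    SplitRank I m (permForm k π f) := by
  obtain ⟨β, γ, hβ, hγ, rfl⟩ := h
  refine ⟨fun i => _root_.permForm k π (β i), fun i => _root_.permForm k π (γ i),
    fun i => (hβ i).permForm π, fun i => MultilinearOn.permForm π ?_, ?_⟩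
  · have : (univ \ I).map π.toEmbedding = univ \ I.map π.toEmbedding := by
      ext j
      simp [Finset.mem_map_equiv]
    rw [this]
    exact hγ i
  · funext x
    simp [_root_.permForm, Finset.sum_apply]

theorem SplitRank.isMultilinear {I : Finset (Fin k)} {m : ℕ} {f : (Fin k → V) → ZMod 2}
    (h : SplitRank I m f) : IsMultilinear k f := by
  obtain ⟨β, γ, hβ, hγ, rfl⟩ := h
  refine MultilinearOn.sum _ fun i _ => ?_
  have := (hβ i).mul (hγ i) Finset.disjoint_sdiff
  rwa [Finset.union_sdiff_of_subset (Finset.subset_univ _)] at this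

theorem prankDecompOn_iff {m : ℕ} {f : (Fin k → V) → ZMod 2} :
    PrankDecompOn k univ m f ↔ ∃ (I : Fin m → Finset (Fin k))
      (β γ : Fin m → ((Fin k → V) → ZMod 2)), (∀ i, I i ≠ ∅) ∧ (∀ i, I i ≠ univ) ∧
      (∀ i, MultilinearOn k (I i) (β i)) ∧ (∀ i, MultilinearOn k (univ \ I i) (γ i)) ∧
      f = ∑ i, β i * γ i := by
  constructor
  · rintro ⟨I, β, γ, -, h1, h2, h3, h4, h5⟩
    exact ⟨I, β, γ, h1, h2, h3, h4, by funext x; simp [h5, Finset.sum_apply]⟩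
  · rintro ⟨I, β, γ, h1, h2, h3, h4, rfl⟩
    exact ⟨I, β, γ, fun _ => Finset.subset_univ _, h1, h2, h3, h4,
      fun x => by simp [Finset.sum_apply]⟩

theorem PrankDecompOn.zero : PrankDecompOn k univ 0 (0 : (Fin k → V) → ZMod 2) :=
  prankDecompOn_iff.2 ⟨Fin.elim0, Fin.elim0, Fin.elim0, fun i => i.elim0, fun i => i.elim0,
    fun i => i.elim0, fun i => i.elim0, by simp⟩

theorem PrankDecompOn.add {m m' : ℕ} {f f' : (Fin k → V) → ZMod 2}
    (h : PrankDecompOn k univ m f) (h' : PrankDecompOn k univ m' f') :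
    PrankDecompOn k univ (m + m') (f + f') := by
  obtain ⟨I, β, γ, h1, h2, hβ, hγ, rfl⟩ := prankDecompOn_iff.1 h
  obtain ⟨I', β', γ', h1', h2', hβ', hγ', rfl⟩ := prankDecompOn_iff.1 h'
  refine prankDecompOn_iff.2 ⟨Fin.append I I', Fin.append β β', Fin.append γ γ',
    ?_, ?_, ?_, ?_, by simp [Fin.sum_univ_add]⟩ <;>
  · intro i
    refine Fin.addCases (fun i => ?_) (fun i => ?_) i <;> simp [*]

theorem PrankDecompOn.sum {ι : Type*} (s : Finset ι) {m : ι → ℕ}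
    {f : ι → (Fin k → V) → ZMod 2} (hf : ∀ i ∈ s, PrankDecompOn k univ (m i) (f i)) :
    PrankDecompOn k univ (∑ i ∈ s, m i) (∑ i ∈ s, f i) := by
  classical
  induction s using Finset.induction_on with
  | empty => exact PrankDecompOn.zero
  | insert a s ha ih =>
    rw [Finset.sum_insert ha, Finset.sum_insert ha]
    exact (hf a (by simp)).add (ih fun i hi => hf i (by simp [hi]))

theorem SplitRank.prankDecompOn {I : Finset (Fin k)} {m : ℕ} {f : (Fin k → V) → ZMod 2}
    (h : SplitRank I m f) (h0 : I ≠ ∅) (h1 : I ≠ univ) : PrankDecompOn k univ m f := by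
  obtain ⟨β, γ, hβ, hγ, rfl⟩ := h
  exact prankDecompOn_iff.2 ⟨fun _ => I, β, γ, fun _ => h0, fun _ => h1, hβ, hγ, rfl⟩

theorem PrankDecompOn.mul {I : Finset (Fin k)} {β γ : (Fin k → V) → ZMod 2} (h0 : I ≠ ∅)
    (h1 : I ≠ univ) (hβ : MultilinearOn k I β) (hγ : MultilinearOn k (univ \ I) γ) :
    PrankDecompOn k univ 1 (β * γ) :=
  SplitRank.prankDecompOn ⟨fun _ => β, fun _ => γ, fun _ => hβ, fun _ => hγ, by simp⟩ h0 h1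

theorem PrankDecompOn.prank_le {m : ℕ} {f : (Fin k → V) → ZMod 2}
    (h : PrankDecompOn k univ m f) : prank k f ≤ m :=
  Nat.sInf_le h

theorem PrankDecompOn.isMultilinear {m : ℕ} {f : (Fin k → V) → ZMod 2}
    (h : PrankDecompOn k univ m f) : IsMultilinear k f := by
  obtain ⟨I, β, γ, -, -, hβ, hγ, rfl⟩ := prankDecompOn_iff.1 h
  refine MultilinearOn.sum _ fun i _ => ?_
  have := (hβ i).mul (hγ i) Finset.disjoint_sdiff
  rwa [Finset.union_sdiff_of_subset (Finset.subset_univ _)] at this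

end Multilinear

section Coordinates

variable {V : Type*} [AddCommGroup V] [Module (ZMod 2) V] {k : ℕ}

theorem MultilinearOn.update_zero {S : Finset (Fin k)} {f : (Fin k → V) → ZMod 2}
    (hf : MultilinearOn k S f) {i : Fin k} (hi : i ∈ S) (x : Fin k → V) :
    f (Function.update x i 0) = 0 := by
  have := hf.2 i hi x 0 0
  simpa using this

/-- The linear functional obtained by freezing all the variables but one. -/
def MultilinearOn.slice {S : Finset (Fin k)} {f : (Fin k → V) → ZMod 2}
    (hf : MultilinearOn k S f) {i : Fin k} (hi : i ∈ S) (x : Fin k → V) :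
    V →ₗ[ZMod 2] ZMod 2 :=
  AddMonoidHom.toZModLinearMap 2
    (AddMonoidHom.mk' (fun v => f (Function.update x i v)) fun u v => hf.2 i hi x u v)

theorem MultilinearOn.slice_apply {S : Finset (Fin k)} {f : (Fin k → V) → ZMod 2}
    (hf : MultilinearOn k S f) {i : Fin k} (hi : i ∈ S) (x : Fin k → V) (v : V) :
    hf.slice hi x v = f (Function.update x i v) := rfl

theorem prankDecompOn_add_pull {ι : Type*} [Fintype ι] (hk : 2 ≤ k)
    {f : (Fin k → V) → ZMod 2} (hf : IsMultilinear k f) (p : V →ₗ[ZMod 2] V)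
    (l : ι → V →ₗ[ZMod 2] ZMod 2) (e : ι → V) (hp : ∀ x, p x = x + ∑ j, l j x • e j) :
    PrankDecompOn k univ (k * Fintype.card ι) (f + pull p f) := by
  set q : ℕ → Fin k → V →ₗ[ZMod 2] V := fun m i => if (i : ℕ) < m then p else LinearMap.id
    with hq
  have main : ∀ m ≤ k, PrankDecompOn k univ (m * Fintype.card ι) (f + pullFam (q m) f) := by
    intro m
    induction m with
    | zero =>
      intro _
      have : f + pullFam (q 0) f = 0 := by
        rw [← form_add_self f]
        rfl
      rw [this, Nat.zero_mul]
      exact PrankDecompOn.zero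
    | succ m ih =>
      intro hm
      have h1 := ih (by omega)
      set i : Fin k := ⟨m, by omega⟩ with hi
      have h2 : PrankDecompOn k univ (∑ _j : ι, 1)
          (∑ j, (fun x : Fin k → V => l j (x i)) *
            (fun x => pullFam (q m) f (Function.update x i (e j)))) := by
        refine PrankDecompOn.sum _ fun j _ => PrankDecompOn.mul (I := {i}) (by simp) ?_ ?_ ?_
        · intro h
          have := congrArg Finset.card h
          simp at this
          omega
        · refine ⟨fun x y h => by simp [h i (by simp)], fun i' hi' x u v => ?_⟩
          rw [Finset.mem_singleton.1 hi']
          simp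
        · exact (MultilinearOn.pullFam hf (q m)).contract i (e j)
      have h3 := h1.add h2
      have h4 : f + pullFam (q (m + 1)) f = f + pullFam (q m) f +
          (∑ j, (fun x : Fin k → V => l j (x i)) *
            (fun x => pullFam (q m) f (Function.update x i (e j)))) := by
        rw [add_assoc]
        congr 1
        funext x
        have hML := MultilinearOn.pullFam hf (q m)
        have h5 : pullFam (q (m + 1)) f x = pullFam (q m) f (Function.update x i (p (x i))) := by
          unfold pullFam
          congr 1
          funext j
          by_cases hj : j = i
          · subst hj; simp [hq, hi]
          · have : (j : ℕ) ≠ m := fun h => hj (Fin.ext h)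
            have h' : (j : ℕ) < m + 1 ↔ (j : ℕ) < m := by omega
            simp [hq, hj, h']
        rw [h5, hp, ← hML.slice_apply (Finset.mem_univ i) x, map_add, map_sum]
        simp only [map_smul]
        simp [hML.slice_apply (Finset.mem_univ i) x, Finset.sum_apply]
      rw [h4]
      convert h3 using 1
      simp [Nat.succ_mul]
  have := main k le_rfl
  have hqk : pullFam (q k) f = pull p f := by
    funext x
    simp [pullFam, pull, hq]
  rwa [hqk] at this

theorem prankDecompOn_of_isMultilinear {n : ℕ} (hk : 2 ≤ k)
    {f : (Fin k → Fin n → ZMod 2) → ZMod 2} (hf : IsMultilinear k f) :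
    PrankDecompOn k univ (k * n) f := by
  have := prankDecompOn_add_pull hk hf 0 (fun a : Fin n => LinearMap.proj a)
    (fun a => Pi.single a 1) (fun x => by
      funext b
      simp [Finset.sum_apply, Pi.single_apply, CharTwo.add_self_eq_zero])
  have h0 : pull (0 : (Fin n → ZMod 2) →ₗ[ZMod 2] _) f = 0 := by
    funext x
    have := MultilinearOn.update_zero hf (Finset.mem_univ (⟨0, by omega⟩ : Fin k)) 0
    rw [Function.update_eq_self_iff.2 (by simp)] at this
    exact this
  rwa [h0, add_zero, Fintype.card_fin] at this

theorem prankDecompOn_prank {n : ℕ} (hk : 2 ≤ k)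
    {f : (Fin k → Fin n → ZMod 2) → ZMod 2} (hf : IsMultilinear k f) :
    PrankDecompOn k univ (prank k f) f :=
  Nat.sInf_mem (s := {m | PrankDecompOn k univ m f}) ⟨_, prankDecompOn_of_isMultilinear hk hf⟩

/-- A bounded family of linear functionals vanishes on the range of a bounded-rank
perturbation of the identity. -/
theorem exists_projection {ι : Type*} [Fintype ι]
    (l : ι → V →ₗ[ZMod 2] ZMod 2) :
    ∃ (p : V →ₗ[ZMod 2] V) (e : ι → V), (∀ x, p x = x + ∑ j, l j x • e j) ∧
      ∀ i x, l i (p x) = 0 := by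
  classical
  set L : V →ₗ[ZMod 2] (ι → ZMod 2) := LinearMap.pi l with hL
  obtain ⟨g, hg⟩ := LinearMap.exists_rightInverse_of_surjective L.rangeRestrict
    (LinearMap.range_rangeRestrict L)
  obtain ⟨s, hs⟩ := LinearMap.exists_extend g
  have key : ∀ x, L (s (L x)) = L x := by
    intro x
    have h1 : s (L x) = g (L.rangeRestrict x) := by
      rw [← hs]; rfl
    have h2 := LinearMap.congr_fun hg (L.rangeRestrict x)
    rw [h1]
    exact congrArg Subtype.val h2
  refine ⟨LinearMap.id + s ∘ₗ L, fun j => s (Pi.single j 1), fun x => ?_, fun i x => ?_⟩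
  · have : L x = ∑ j, l j x • (Pi.single j 1 : ι → ZMod 2) := by
      funext i
      simp [hL, Finset.sum_apply, Pi.single_apply]
    simp only [LinearMap.add_apply, LinearMap.id_apply, LinearMap.comp_apply]
    rw [this, map_sum]
    simp
  · have h := congrFun (key x) i
    simp only [hL, LinearMap.pi_apply] at h
    simp only [LinearMap.add_apply, LinearMap.id_apply, LinearMap.comp_apply, map_add]
    rw [h]
    exact CharTwo.add_self_eq_zero _

end Coordinates

section Alternating

variable {n k : ℕ}

/-- The strictly upper triangular part of a form, seen as a bilinear form in the variables
`i` and `j`. -/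
def upperPart (i j : Fin k) (f : (Fin k → Fin n → ZMod 2) → ZMod 2) :
    (Fin k → Fin n → ZMod 2) → ZMod 2 :=
  fun x => ∑ a, ∑ b, if a < b then x i a * x j b *
    f (Function.update (Function.update x i (Pi.single a 1)) j (Pi.single b 1)) else 0

theorem upperPart_sum_mul {m : ℕ} (i j : Fin k) (β γ : Fin m → (Fin k → Fin n → ZMod 2) → ZMod 2)
    (h : ∀ l x u v, γ l (Function.update (Function.update x i u) j v) = γ l x) :
    upperPart i j (∑ l, β l * γ l) = ∑ l, upperPart i j (β l) * γ l := by
  funext x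
  simp only [upperPart, Finset.sum_apply, Pi.mul_apply, h, Finset.sum_mul]
  conv_rhs => rw [Finset.sum_comm]
  refine Finset.sum_congr rfl fun a _ => ?_
  conv_rhs => rw [Finset.sum_comm]
  refine Finset.sum_congr rfl fun b _ => ?_
  split_ifs
  · rw [Finset.mul_sum]
    exact Finset.sum_congr rfl fun l _ => by ring
  · simp

theorem MultilinearOn.upperPart {S : Finset (Fin k)} {f : (Fin k → Fin n → ZMod 2) → ZMod 2}
    (hf : MultilinearOn k S f) {i j : Fin k} (hij : i ≠ j) (hi : i ∈ S) (hj : j ∈ S) :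
    MultilinearOn k S (upperPart i j f) := by
  refine ⟨fun x y h => ?_, fun l hl x u v => ?_⟩
  · unfold _root_.upperPart
    refine Finset.sum_congr rfl fun a _ => Finset.sum_congr rfl fun b _ => ?_
    rw [h i hi, h j hj, hf.1 _ (Function.update (Function.update y i (Pi.single a 1)) j
      (Pi.single b 1)) fun l hl => ?_]
    simp only [Function.update_apply, h l hl]
  · simp only [_root_.upperPart, ← Finset.sum_add_distrib]
    refine Finset.sum_congr rfl fun a _ => Finset.sum_congr rfl fun b _ => ?_
    split_ifs with hab
    · by_cases hli : l = i
      · subst hli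
        simp [hij.symm]
        ring
      · by_cases hlj : l = j
        · subst hlj
          simp [Function.update_comm hij, hij]
          ring
        · simp only [Function.update_comm hli, Function.update_comm hlj, hf.2 l hl]
          simp [Ne.symm hli, Ne.symm hlj]
          ring
    · simp

theorem upperPart_permForm {i j : Fin k} (σ : Equiv.Perm (Fin k)) (hi : σ i = i) (hj : σ j = j)
    (f : (Fin k → Fin n → ZMod 2) → ZMod 2) :
    permForm k σ (upperPart i j f) = upperPart i j (permForm k σ f) := by
  have hi' : σ.symm i = i := by rw [Equiv.symm_apply_eq, hi]
  have hj' : σ.symm j = j := by rw [Equiv.symm_apply_eq, hj]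
  funext x
  simp only [permForm, upperPart, update_comp_perm, hi, hj, hi', hj']

theorem biadditive_alternating {h : (Fin n → ZMod 2) → (Fin n → ZMod 2) → ZMod 2}
    (h1 : ∀ u u' v, h (u + u') v = h u v + h u' v)
    (h2 : ∀ u v v', h u (v + v') = h u v + h u v') (h0 : ∀ u, h u u = 0)
    (u v : Fin n → ZMod 2) :
    h u v = (∑ a, ∑ b, if a < b then u a * v b * h (Pi.single a 1) (Pi.single b 1) else 0) +
      ∑ a, ∑ b, if a < b then v a * u b * h (Pi.single a 1) (Pi.single b 1) else 0 := by
  have hsymm : ∀ u v, h u v = h v u := by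
    intro u v
    have := h0 (u + v)
    rw [h1, h2, h2, h0, h0, zero_add, add_zero] at this
    exact CharTwo.add_eq_zero.1 this
  let H : (Fin n → ZMod 2) →ₗ[ZMod 2] (Fin n → ZMod 2) →ₗ[ZMod 2] ZMod 2 :=
    AddMonoidHom.toZModLinearMap 2 (AddMonoidHom.mk' (fun u =>
      AddMonoidHom.toZModLinearMap 2 (AddMonoidHom.mk' (h u) (h2 u))) fun u u' => by
        ext v; simp [h1])
  have hH : ∀ u v, h u v = H u v := fun _ _ => rfl
  have expand : h u v = ∑ a, ∑ b, u a * v b * h (Pi.single a 1) (Pi.single b 1) := by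
    have e : ∀ w : Fin n → ZMod 2, w = ∑ a, w a • (Pi.single a 1 : Fin n → ZMod 2) := by
      intro w
      funext b
      simp [Finset.sum_apply, Pi.single_apply]
    simp only [hH]
    conv_lhs => rw [e u, e v]
    simp only [map_sum, LinearMap.sum_apply, map_smul, LinearMap.smul_apply, smul_eq_mul,
      Finset.mul_sum]
    rw [Finset.sum_comm]
    refine Finset.sum_congr rfl fun a _ => Finset.sum_congr rfl fun b _ => ?_
    ring
  rw [expand]
  conv_rhs => rw [add_comm, Finset.sum_comm, add_comm]
  rw [← Finset.sum_add_distrib]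
  refine Finset.sum_congr rfl fun a _ => ?_
  rw [← Finset.sum_add_distrib]
  refine Finset.sum_congr rfl fun b _ => ?_
  rcases lt_trichotomy a b with hab | hab | hab
  · simp [hab, hab.not_gt]
  · subst hab; simp [h0]
  · simp only [hab, hab.not_gt, if_true, if_false, zero_add]
    rw [hsymm]
    ring

theorem eq_upperPart_add_swap {f : (Fin k → Fin n → ZMod 2) → ZMod 2} (hf : IsMultilinear k f)
    {i j : Fin k} (hij : i ≠ j) (h0 : ∀ x, x i = x j → f x = 0) :
    f = upperPart i j f + permForm k (Equiv.swap i j) (upperPart i j f) := by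
  funext x
  have := biadditive_alternating
    (h := fun u v => f (Function.update (Function.update x i u) j v))
    (fun u u' v => by
      simp only [Function.update_comm hij]
      exact hf.2 i (Finset.mem_univ _) _ _ _)
    (fun u v v' => hf.2 j (Finset.mem_univ _) _ _ _)
    (fun u => h0 _ (by simp [hij])) (x i) (x j)
  simp only [Function.update_eq_self] at this
  rw [this]
  simp only [Pi.add_apply, upperPart, permForm, Equiv.symm_swap, Equiv.swap_apply_left,
    Equiv.swap_apply_right]
  congr 1
  refine Finset.sum_congr rfl fun a _ => Finset.sum_congr rfl fun b _ => ?_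
  congr 3
  funext l
  by_cases hj : l = j
  · simp [hj]
  · by_cases hi : l = i
    · subst hi; simp [hij]
    · simp [hi, hj, Equiv.swap_apply_of_ne_of_ne hi hj]

theorem SplitRank.upperPart {I : Finset (Fin k)} {m : ℕ}
    {f : (Fin k → Fin n → ZMod 2) → ZMod 2} (hf : SplitRank I m f) {i j : Fin k} (hij : i ≠ j)
    (hI : i ∈ I ↔ j ∈ I) : SplitRank I m (upperPart i j f) := by
  obtain ⟨β, γ, hβ, hγ, rfl⟩ := hf
  by_cases hi : i ∈ I
  · refine ⟨fun l => _root_.upperPart i j (β l), γ,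
      fun l => (hβ l).upperPart hij hi (hI.1 hi), hγ, upperPart_sum_mul i j β γ ?_⟩
    intro l x u v
    rw [(hγ l).update_of_notMem (by simp [hI.1 hi]), (hγ l).update_of_notMem (by simp [hi])]
  · have hj : j ∉ I := fun h => hi (hI.2 h)
    refine ⟨β, fun l => _root_.upperPart i j (γ l), hβ,
      fun l => (hγ l).upperPart hij (by simp [hi]) (by simp [hj]), ?_⟩
    simp only [mul_comm (β _)]
    refine upperPart_sum_mul i j γ β ?_
    intro l x u v
    rw [(hβ l).update_of_notMem hj, (hβ l).update_of_notMem hi]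

end Alternating

section Descent

variable {n : ℕ}

/-- The pairs of indices among five variables. -/
def indexPairs : Finset (Finset (Fin 5)) := Finset.powersetCard 2 univ

/-- Pairs of indices together with a distinguished index outside the pair. -/
def markedPairs : Finset (Finset (Fin 5) × Fin 5) :=
  (indexPairs ×ˢ univ).filter fun q => q.2 ∉ q.1

theorem exists_perm_markedPair (q : Finset (Fin 5) × Fin 5) (hq : q ∈ markedPairs) :
    ∃ π : Equiv.Perm (Fin 5), q.1.map π.toEmbedding = {0, 1} ∧ π q.2 = 4 := by
  revert q
  decide +kernel

theorem perm_stabilizer (s : Equiv.Perm (Fin 5))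
    (h : ({0, 1} : Finset (Fin 5)).map s.toEmbedding = {0, 1}) (h4 : s 4 = 4) :
    s = 1 ∨ s = Equiv.swap 0 1 ∨ s = Equiv.swap 2 3 ∨ s = Equiv.swap 0 1 * Equiv.swap 2 3 := by
  revert s
  decide +kernel

theorem sum_markedPairs {M : Type*} [AddCommGroup M] (f : Finset (Fin 5) → M)
    (h2 : ∀ I, f I + f I = 0) : ∑ q ∈ markedPairs, f q.1 = ∑ I ∈ indexPairs, f I := by
  have h3 : ∀ I ∈ indexPairs, (univ.filter fun m : Fin 5 => m ∉ I).card = 3 := by decide +kernel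
  rw [markedPairs, Finset.sum_filter, Finset.sum_product]
  refine Finset.sum_congr rfl fun I hI => ?_
  simp only
  rw [← Finset.sum_filter, Finset.sum_const, h3 I hI, succ_nsmul, two_nsmul, h2, zero_add]

theorem sum_markedPairs_perm {M : Type*} [AddCommMonoid M] (g : Equiv.Perm (Fin 5))
    (f : Finset (Fin 5) × Fin 5 → M) :
    ∑ q ∈ markedPairs, f (q.1.map g.toEmbedding, g q.2) = ∑ q ∈ markedPairs, f q := by
  refine Finset.sum_bij' (fun q _ => (q.1.map g.toEmbedding, g q.2))
    (fun q _ => (q.1.map g.symm.toEmbedding, g.symm q.2)) ?_ ?_ ?_ ?_ ?_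
  · intro q hq
    simpa [markedPairs, indexPairs] using hq
  · intro q hq
    simpa [markedPairs, indexPairs] using hq
  · intro q _
    ext <;> simp [Finset.mem_map_equiv]
  · intro q _
    ext <;> simp [Finset.mem_map_equiv]
  · intro q _
    rfl

/-- A cocycle of forms splitting along pairs, which is suitably alternating, is the coboundary of
a form of bounded partition rank. -/
theorem exists_symmetric_of_cocycle (A : (Fin 5 → Fin n → ZMod 2) → ZMod 2) (r : ℕ)
    (F : Equiv.Perm (Fin 5) → Finset (Fin 5) → (Fin 5 → Fin n → ZMod 2) → ZMod 2)
    (hA : ∀ π, A + permForm 5 π A = ∑ I ∈ indexPairs, F π I)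
    (hF : ∀ π, ∀ I ∈ indexPairs, SplitRank I r (F π I))
    (hcoc : ∀ g h, ∀ I ∈ indexPairs,
      F (h * g) I = F g I + permForm 5 g (F h (I.map g.toEmbedding)))
    (h01 : ∀ x, x 0 = x 1 → F (Equiv.swap 0 1) {0, 1} x = 0)
    (h23 : ∀ x, x 2 = x 3 → F (Equiv.swap 2 3) {0, 1} x = 0) :
    ∃ ψ, PrankDecompOn 5 univ (30 * (5 * r)) ψ ∧ SymmetricForm 5 (A + ψ) := by
  set s : Equiv.Perm (Fin 5) := Equiv.swap 0 1 with hs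
  set t : Equiv.Perm (Fin 5) := Equiv.swap 2 3 with ht
  set I₀ : Finset (Fin 5) := {0, 1} with hI₀
  have hI₀p : I₀ ∈ indexPairs := by decide
  have hsI : I₀.map s.toEmbedding = I₀ := by decide
  have htI : I₀.map t.toEmbedding = I₀ := by decide
  have hst : s * t = t * s := by decide
  have two : ∀ f g : (Fin 5 → Fin n → ZMod 2) → ZMod 2, f + (f + g) = g := fun f g => by
    rw [← add_assoc, form_add_self, zero_add]
  have hcomm : F s I₀ + permForm 5 s (F t I₀) = F t I₀ + permForm 5 t (F s I₀) := by
    have h1 := hcoc s t I₀ hI₀p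
    have h2 := hcoc t s I₀ hI₀p
    rw [hsI] at h1
    rw [htI] at h2
    rw [← h1, ← h2, hst]
  -- split the component of the transposition `t`
  obtain ⟨ψ₀, hψ₀, hψ₀t⟩ : ∃ ψ₀, SplitRank I₀ r ψ₀ ∧ F t I₀ = ψ₀ + permForm 5 t ψ₀ :=
    ⟨upperPart 2 3 (F t I₀), (hF t I₀ hI₀p).upperPart (by decide) (by decide),
      eq_upperPart_add_swap (hF t I₀ hI₀p).isMultilinear (by decide) h23⟩
  have hψt : permForm 5 t ψ₀ = ψ₀ + F t I₀ := by rw [hψ₀t, two]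
  set f' := F s I₀ + (ψ₀ + permForm 5 s ψ₀) with hf'
  have hrank : SplitRank I₀ (r + (r + r)) f' :=
    (hF s I₀ hI₀p).add (hψ₀.add (SplitRank.permForm s (by rwa [hsI])))
  have hzero : ∀ x, x 0 = x 1 → f' x = 0 := by
    intro x hx
    have : (fun i => x (s.symm i)) = x := by
      funext i
      rw [hs, Equiv.symm_swap, Equiv.swap_apply_def]
      split_ifs with h h
      · rw [h, hx]
      · rw [h, hx]
      · rfl
    simp only [hf', Pi.add_apply, h01 x hx, permForm, this, zero_add]
    exact CharTwo.add_self_eq_zero _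
  have hswap : permForm 5 t f' = f' := by
    rw [hf', permForm_add, permForm_add, permForm_permForm, hst, ← permForm_permForm, hψt,
      permForm_add]
    have h3 : permForm 5 t (F s I₀) = F t I₀ + (F s I₀ + permForm 5 s (F t I₀)) := by
      rw [hcomm, two]
    rw [h3]
    have e1 := form_add_self (F t I₀)
    have e2 := form_add_self (permForm 5 s (F t I₀))
    linear_combination (exp := 1) e1 + e2
  obtain ⟨ψ₁, hψ₁, hψ₁s, hψ₁t⟩ : ∃ ψ₁, SplitRank I₀ (r + (r + r)) ψ₁ ∧
      f' = ψ₁ + permForm 5 s ψ₁ ∧ permForm 5 t ψ₁ = ψ₁ := by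
    refine ⟨upperPart 0 1 f', hrank.upperPart (by decide) (by decide),
      eq_upperPart_add_swap hrank.isMultilinear (by decide) hzero, ?_⟩
    rw [upperPart_permForm t (by decide) (by decide), hswap]
  set θ := ψ₀ + ψ₁ with hθ
  have hθrank : SplitRank I₀ (4 * r) θ := by
    have := hψ₀.add hψ₁
    rwa [show r + (r + (r + r)) = 4 * r by ring] at this
  have hθt : permForm 5 t θ = θ + F t I₀ := by
    rw [hθ, permForm_add, hψ₁t, hψt]; abel
  have hθs : permForm 5 s θ = θ + F s I₀ := by
    have : permForm 5 s ψ₁ = ψ₁ + f' := by rw [hψ₁s, two]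
    rw [hθ, permForm_add, this, hf']
    have e1 := form_add_self (permForm 5 s ψ₀)
    linear_combination (exp := 1) e1
  -- transport `θ` to the other pairs
  set pre : Equiv.Perm (Fin 5) → Finset (Fin 5) := fun π => I₀.map π.symm.toEmbedding with hpre
  have hpre_mem : ∀ π, pre π ∈ indexPairs := by
    intro π
    simp [hpre, indexPairs, hI₀]
  have hmap : ∀ π, (pre π).map π.toEmbedding = I₀ := by
    intro π
    ext i
    simp [hpre, Finset.mem_map_equiv]
  set Θ : Equiv.Perm (Fin 5) → (Fin 5 → Fin n → ZMod 2) → ZMod 2 :=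
    fun π => permForm 5 π θ + F π (pre π) with hΘ
  have hΘu : ∀ u, I₀.map u.toEmbedding = I₀ → permForm 5 u θ = θ + F u I₀ →
      ∀ π, Θ (u * π) = Θ π := by
    intro u hu hθu π
    have h1 : pre (u * π) = pre π := by
      ext i
      have := congrArg (fun I => u (π i) ∈ I) hu
      simp only [Finset.mem_map_equiv, Equiv.symm_apply_apply] at this
      simp [hpre, Finset.mem_map_equiv, this]
    simp only [hΘ]
    rw [h1, hcoc π u _ (hpre_mem π), hmap, ← permForm_permForm, hθu, permForm_add]
    have e1 := form_add_self (permForm 5 π (F u I₀))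
    linear_combination (exp := 1) e1
  have hΘst : ∀ π π' : Equiv.Perm (Fin 5), pre π = pre π' → π.symm 4 = π'.symm 4 →
      Θ π = Θ π' := by
    intro π π' h h4
    have h5 : π = (π * π'⁻¹) * π' := by group
    have h6 : I₀.map (π * π'⁻¹).toEmbedding = I₀ := by
      ext i
      have h' := congrArg (fun I => π.symm i ∈ I) h
      simp only [hpre, Finset.mem_map_equiv, Equiv.symm_symm, Equiv.apply_symm_apply] at h'
      rw [Finset.mem_map_equiv, h']
      rfl
    have h7 : (π * π'⁻¹) 4 = 4 := by
      show π (π'.symm 4) = 4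
      rw [← h4]; simp
    rw [h5]
    rcases perm_stabilizer _ h6 h7 with h8 | h8 | h8 | h8 <;> rw [h8]
    · rw [one_mul]
    · exact hΘu s hsI hθs π'
    · exact hΘu t htI hθt π'
    · rw [mul_assoc, hΘu s hsI hθs, hΘu t htI hθt]
  have hΘg : ∀ π g, permForm 5 g (Θ π) = Θ (π * g) + F g (pre (π * g)) := by
    intro π g
    have h1 : (pre (π * g)).map g.toEmbedding = pre π := by
      ext i
      simp [hpre, Finset.mem_map_equiv]
    simp only [hΘ]
    rw [hcoc g π _ (hpre_mem _), h1, permForm_add, permForm_permForm]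
    have e1 := form_add_self (F g (pre (π * g)))
    linear_combination (exp := 1) -e1
  choose! rep hrep hrep4 using exists_perm_markedPair
  have hprerep : ∀ q ∈ markedPairs, pre (rep q) = q.1 := by
    intro q hq
    simp only [hpre, hI₀]
    rw [← hrep q hq]
    ext i
    simp [Finset.mem_map_equiv]
  have hrank : ∀ π, PrankDecompOn 5 univ (5 * r) (Θ π) := by
    intro π
    have h1 : SplitRank (pre π) (4 * r) (permForm 5 π θ) :=
      SplitRank.permForm π (by rwa [hmap])
    have h2 := (h1.add (hF π _ (hpre_mem π))).prankDecompOn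
      (by simp [hpre, hI₀]) (by
        intro h
        have := hpre_mem π
        rw [h] at this
        revert this
        decide)
    rwa [show 4 * r + r = 5 * r by ring] at h2
  refine ⟨∑ q ∈ markedPairs, Θ (rep q), ?_, ?_⟩
  · have h := PrankDecompOn.sum markedPairs (m := fun _ => 5 * r)
      (f := fun q => Θ (rep q)) fun q _ => hrank _
    rw [Finset.sum_const, show markedPairs.card = 30 by decide +kernel] at h
    exact h
  · intro g
    have h1 : permForm 5 g (∑ q ∈ markedPairs, Θ (rep q)) =
        ∑ q ∈ markedPairs, (Θ (rep q) + F g q.1) := by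
      rw [permForm_sum, ← sum_markedPairs_perm g]
      refine Finset.sum_congr rfl fun q hq => ?_
      have hq' : (q.1.map g.toEmbedding, g q.2) ∈ markedPairs := by
        simpa [markedPairs, indexPairs] using hq
      have h2 : pre (rep (q.1.map g.toEmbedding, g q.2) * g) = q.1 := by
        have := hprerep _ hq'
        ext i
        have := congrArg (fun I => g i ∈ I) this
        simpa [hpre, Finset.mem_map_equiv] using this
      rw [hΘg, h2]
      congr 1
      apply hΘst
      · rw [h2, hprerep q hq]
      · have h3 := hrep4 _ hq'
        have h4 := hrep4 _ hq
        rw [Equiv.symm_apply_eq]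
        rw [← h4]
        simp only [Equiv.symm_apply_apply]
        rw [h4]
        exact h3.symm
    have h2 : ∑ q ∈ markedPairs, F g q.1 = A + permForm 5 g A := by
      rw [hA g]
      exact sum_markedPairs (F g) fun I => form_add_self _
    rw [permForm_add, h1, Finset.sum_add_distrib, h2]
    have e1 := form_add_self (permForm 5 g A)
    linear_combination (exp := 1) e1

end Descent

section Separation

variable {V : Type*} [AddCommGroup V] [Module (ZMod 2) V]

/-- A form which is, in the pair `I` of variables, a bilinear form from `B`, and which vanishes
whenever another pair of variables takes values in `D` and the other variables lie in `U`. -/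
structure CleanOn (B : Submodule (ZMod 2) (V →ₗ[ZMod 2] V →ₗ[ZMod 2] ZMod 2)) (D U : Set V)
    (I : Finset (Fin 5)) (h : (Fin 5 → V) → ZMod 2) : Prop where
  slice : ∀ i j, i ≠ j → I = {i, j} → ∀ x, ∃ b ∈ B, ∀ u v,
    h (Function.update (Function.update x i u) j v) = b u v
  vanish : ∀ i j, i ≠ j → {i, j} ≠ I → ∀ x, x i ∈ D → x j ∈ D →
    (∀ l, l ≠ i → l ≠ j → x l ∈ U) → h x = 0

variable {B : Submodule (ZMod 2) (V →ₗ[ZMod 2] V →ₗ[ZMod 2] ZMod 2)} {D U : Set V}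

theorem CleanOn.add {I : Finset (Fin 5)} {h h' : (Fin 5 → V) → ZMod 2}
    (H : CleanOn B D U I h) (H' : CleanOn B D U I h') : CleanOn B D U I (h + h') := by
  refine ⟨fun i j hij hI x => ?_, fun i j hij hI x hi hj hl => ?_⟩
  · obtain ⟨b, hb, e⟩ := H.slice i j hij hI x
    obtain ⟨b', hb', e'⟩ := H'.slice i j hij hI x
    exact ⟨b + b', B.add_mem hb hb', fun u v => by simp [e, e']⟩
  · simp [H.vanish i j hij hI x hi hj hl, H'.vanish i j hij hI x hi hj hl]

theorem CleanOn.permForm {I : Finset (Fin 5)} {h : (Fin 5 → V) → ZMod 2}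
    (g : Equiv.Perm (Fin 5)) (H : CleanOn B D U (I.map g.toEmbedding) h) :
    CleanOn B D U I (permForm 5 g h) := by
  refine ⟨fun i j hij hI x => ?_, fun i j hij hI x hi hj hl => ?_⟩
  · obtain ⟨b, hb, e⟩ := H.slice (g i) (g j) (by simpa using hij) (by rw [hI]; simp)
      (fun l => x (g.symm l))
    refine ⟨b, hb, fun u v => ?_⟩
    simp only [_root_.permForm, update_comp_perm, e]
  · refine H.vanish (g i) (g j) (by simpa using hij) ?_ _ (by simpa using hi)
      (by simpa using hj) ?_
    · intro h'
      apply hI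
      apply Finset.map_injective g.toEmbedding
      rw [← h']
      simp
    · intro l hli hlj
      exact hl _ (fun h' => hli (by rw [← h']; simp)) (fun h' => hlj (by rw [← h']; simp))

theorem CleanOn.eq_zero_of_sum (hD : ∀ b ∈ B, (∀ d ∈ D, ∀ d' ∈ D, b d d' = 0) → b = 0)
    {h : Finset (Fin 5) → (Fin 5 → V) → ZMod 2}
    (H : ∀ I ∈ indexPairs, CleanOn B D U I (h I)) {i j : Fin 5} (hij : i ≠ j) (x : Fin 5 → V)
    (hx : ∀ l, l ≠ i → l ≠ j → x l ∈ U)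
    (hsum : ∀ d ∈ D, ∀ d' ∈ D,
      ∑ I ∈ indexPairs, h I (Function.update (Function.update x i d) j d') = 0) :
    h {i, j} x = 0 := by
  have hmem : ({i, j} : Finset (Fin 5)) ∈ indexPairs := by
    simp [indexPairs, Finset.card_pair hij]
  obtain ⟨b, hb, e⟩ := (H _ hmem).slice i j hij rfl x
  have hb0 : b = 0 := by
    refine hD b hb fun d hd d' hd' => ?_
    rw [← e, ← hsum d hd d' hd', Finset.sum_eq_single_of_mem _ hmem]
    intro J hJ hJne
    refine (H J hJ).vanish i j hij hJne.symm _ (by simpa [hij] using hd) (by simpa using hd') ?_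
    intro l hli hlj
    simpa [hli, hlj] using hx l hli hlj
  have := e (x i) (x j)
  simpa [hb0] using this

/-- The bilinear form obtained by freezing all the variables but two. -/
def MultilinearOn.bislice {k : ℕ} {S : Finset (Fin k)} {f : (Fin k → V) → ZMod 2}
    (hf : MultilinearOn k S f) {i j : Fin k} (hij : i ≠ j) (hi : i ∈ S) (hj : j ∈ S)
    (x : Fin k → V) : V →ₗ[ZMod 2] V →ₗ[ZMod 2] ZMod 2 :=
  AddMonoidHom.toZModLinearMap 2 (AddMonoidHom.mk'
    (fun u => hf.slice hj (Function.update x i u)) fun u u' => by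
      ext v
      simp only [LinearMap.add_apply, hf.slice_apply, Function.update_comm hij]
      exact hf.2 i hi _ _ _)

theorem MultilinearOn.bislice_apply {k : ℕ} {S : Finset (Fin k)} {f : (Fin k → V) → ZMod 2}
    (hf : MultilinearOn k S f) {i j : Fin k} (hij : i ≠ j) (hi : i ∈ S) (hj : j ∈ S)
    (x : Fin k → V) (u v : V) : hf.bislice hij hi hj x u v =
      f (Function.update (Function.update x i u) j v) := rfl

/-- The linear functional `y ↦ b(y, y)` of a symmetric bilinear form over `𝔽₂`. -/
def diagFunctional (b : V →ₗ[ZMod 2] V →ₗ[ZMod 2] ZMod 2) (hb : ∀ u v, b u v = b v u) :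
    V →ₗ[ZMod 2] ZMod 2 :=
  AddMonoidHom.toZModLinearMap 2 (AddMonoidHom.mk' (fun u => b u u) fun u v => by
    simp only [map_add, LinearMap.add_apply, hb v u]
    linear_combination (exp := 1) CharTwo.add_self_eq_zero (b u v))

/-- Indices of the frozen bilinear forms. -/
abbrev BilinIndex (r : ℕ) : Type := Equiv.Perm (Fin 5) × Fin r × Fin 5 × Fin 5

/-- Coefficients of linear combinations of the frozen bilinear forms. -/
abbrev BilinCoeff (r : ℕ) : Type := BilinIndex r → ZMod 2

instance (r : ℕ) : Fintype (BilinCoeff r ⊕ BilinCoeff r) := inferInstance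

/-- Indices of the functionals used to separate the components. -/
abbrev SepIndex (r : ℕ) : Type :=
  (BilinCoeff r × (BilinCoeff r ⊕ BilinCoeff r)) ⊕
    ((BilinCoeff r × (BilinCoeff r ⊕ BilinCoeff r)) ⊕
      ((Equiv.Perm (Fin 5) × Fin r × Fin 5 × (Fin 5 → BilinCoeff r ⊕ BilinCoeff r)) ⊕
        BilinCoeff r))

/-- The number of linear functionals needed to separate the components. -/
def separationBound (r : ℕ) : ℕ :=
  let E := 2 ^ (120 * (r * 25))
  E * (E + E) + (E * (E + E) + (120 * (r * (5 * (E + E) ^ 5)) + E))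

set_option synthInstance.maxSize 2000 in
instance (r : ℕ) : Fintype (SepIndex r) := inferInstance

theorem card_sepIndex (r : ℕ) : Fintype.card (SepIndex r) = separationBound r := by
  simp only [separationBound, Fintype.card_sum, Fintype.card_prod, Fintype.card_fun,
    ZMod.card, Fintype.card_fin, Fintype.card_perm]
  norm_num [Nat.factorial]

/-- The part of `∑ β γ` supported on a given partition. -/
def component {r : ℕ} (J : Fin r → Finset (Fin 5)) (β γ : Fin r → (Fin 5 → V) → ZMod 2)
    (I : Finset (Fin 5)) : (Fin 5 → V) → ZMod 2 :=
  ∑ k, if J k = I then β k * γ k else 0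

theorem exists_cleanOn {r : ℕ} (J : Equiv.Perm (Fin 5) → Fin r → Finset (Fin 5))
    (β γ : Equiv.Perm (Fin 5) → Fin r → (Fin 5 → V) → ZMod 2)
    (hβ : ∀ π k, MultilinearOn 5 (J π k) (β π k))
    (hγ : ∀ π k, MultilinearOn 5 (univ \ J π k) (γ π k)) :
    ∃ (ι : Type) (_ : Fintype ι) (l : ι → V →ₗ[ZMod 2] ZMod 2)
      (B : Submodule (ZMod 2) (V →ₗ[ZMod 2] V →ₗ[ZMod 2] ZMod 2)) (D : Set V),
      Fintype.card ι = separationBound r ∧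
      (∀ b ∈ B, (∀ d ∈ D, ∀ d' ∈ D, b d d' = 0) → b = 0) ∧
      (∀ b ∈ B, (∀ u v, b u v = b v u) → ∀ y, (∀ i, l i y = 0) → b y y = 0) ∧
      ∀ π, ∀ I ∈ indexPairs,
        CleanOn B D {y | ∀ i, l i y = 0} I (component (J π) (β π) (γ π) I) := by
  classical
  let gen : BilinIndex r → V →ₗ[ZMod 2] V →ₗ[ZMod 2] ZMod 2 := fun q =>
    if h : q.2.2.1 ≠ q.2.2.2 ∧ q.2.2.1 ∈ J q.1 q.2.1 ∧ q.2.2.2 ∈ J q.1 q.2.1 then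
      (hβ q.1 q.2.1).bislice h.1 h.2.1 h.2.2 0 else 0
  let b : BilinCoeff r →ₗ[ZMod 2] V →ₗ[ZMod 2] V →ₗ[ZMod 2] ZMod 2 :=
    Fintype.linearCombination (ZMod 2) gen
  have hgen : ∀ q, b (Pi.single q 1) = gen q := by
    intro q
    simp only [b]
    rw [Fintype.linearCombination_apply_single, one_smul]
  have hsep : ∀ ε, ∃ d d', b ε d d' = 0 → b ε = 0 := by
    intro ε
    by_cases h : b ε = 0
    · exact ⟨0, 0, fun _ => h⟩
    · by_contra! hne
      exact h (LinearMap.ext₂ fun d d' => (hne d d').1)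
  choose d d' hd using hsep
  let δ : BilinCoeff r ⊕ BilinCoeff r → V := Sum.elim d d'
  let l : SepIndex r → V →ₗ[ZMod 2] ZMod 2 := Sum.elim (fun q => b q.1 (δ q.2))
    (Sum.elim (fun q => (b q.1).flip (δ q.2)) (Sum.elim
      (fun q => if h : q.2.2.1 ∈ univ \ J q.1 q.2.1 then
        (hγ q.1 q.2.1).slice h (fun i => δ (q.2.2.2 i)) else 0)
      (fun ε => if h : ∀ u v, b ε u v = b ε v u then diagFunctional (b ε) h else 0)))
  refine ⟨SepIndex r, inferInstance, l, LinearMap.range b, Set.range δ, card_sepIndex r, ?_, ?_, ?_⟩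
  · rintro _ ⟨ε, rfl⟩ h
    exact hd ε (h _ ⟨Sum.inl ε, rfl⟩ _ ⟨Sum.inr ε, rfl⟩)
  · rintro _ ⟨ε, rfl⟩ hsymm y hy
    have := hy (Sum.inr (Sum.inr (Sum.inr ε)))
    simp only [l, Sum.elim_inr, dif_pos hsymm] at this
    exact this
  · intro π I hI
    have hIcard : I.card = 2 := (Finset.mem_powersetCard.1 hI).2
    refine ⟨fun i j hij hIij x => ?_, fun i j hij hIij x hi hj hx => ?_⟩
    · refine ⟨∑ k, (if J π k = I then γ π k x else 0) • gen (π, k, i, j), ?_, fun u v => ?_⟩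
      · exact Submodule.sum_mem _ fun k _ => Submodule.smul_mem _ _ ⟨_, hgen _⟩
      · simp only [component, Finset.sum_apply, LinearMap.sum_apply, LinearMap.smul_apply]
        refine Finset.sum_congr rfl fun k _ => ?_
        by_cases hk : J π k = I
        · have hi : i ∈ J π k := by rw [hk, hIij]; simp
          have hj : j ∈ J π k := by rw [hk, hIij]; simp
          have h1 : γ π k (Function.update (Function.update x i u) j v) = γ π k x := by
            rw [(hγ π k).update_of_notMem (by simp [hj]), (hγ π k).update_of_notMem (by simp [hi])]
          have h2 : gen (π, k, i, j) u v = β π k (Function.update (Function.update x i u) j v) := by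
            simp only [gen]
            rw [dif_pos ⟨hij, hi, hj⟩, MultilinearOn.bislice_apply]
            refine (hβ π k).1 _ _ fun m hm => ?_
            rw [hk, hIij] at hm
            rcases Finset.mem_insert.1 hm with rfl | hm
            · simp [hij]
            · rw [Finset.mem_singleton.1 hm]; simp
          simp only [hk, if_true, Pi.mul_apply, h1, h2, smul_eq_mul]
          ring
        · simp [hk]
    · simp only [component, Finset.sum_apply]
      refine Finset.sum_eq_zero fun k _ => ?_
      split_ifs with hk
      swap
      · rfl
      have meet : ∀ i', i' ∈ I → x i' ∈ Set.range δ → ∀ j', j' ∈ I → i' ≠ j' →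
          (∀ m, l m (x j') = 0) → β π k x = 0 := by
        rintro i' hi' ⟨w, hw⟩ j' hj' hne hU
        have h1 := hU (Sum.inl (Pi.single (π, k, i', j') 1, w))
        simp only [l, Sum.elim_inl, hgen, gen] at h1
        rw [dif_pos ⟨hne, by rwa [hk], by rwa [hk]⟩, MultilinearOn.bislice_apply, hw] at h1
        rw [← h1]
        refine (hβ π k).1 _ _ fun m hm => ?_
        have : I = {i', j'} := by
          symm
          apply Finset.eq_of_subset_of_card_le
          · intro z hz
            rcases Finset.mem_insert.1 hz with rfl | hz
            · exact hi'
            · rwa [Finset.mem_singleton.1 hz]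
          · rw [hIcard, Finset.card_pair hne]
        rw [hk, this] at hm
        rcases Finset.mem_insert.1 hm with rfl | hm
        · simp [hne]
        · rw [Finset.mem_singleton.1 hm]; simp
      have other : ∀ i' ∈ I, ∃ j' ∈ I, i' ≠ j' := by
        intro i' hi'
        obtain ⟨j', hj', h⟩ := Finset.exists_mem_ne (by omega : 1 < I.card) i'
        exact ⟨j', hj', h.symm⟩
      simp only [Pi.mul_apply]
      by_cases hiI : i ∈ I
      · obtain ⟨j', hj', hne⟩ := other i hiI
        have hjj' : j' ≠ j := by
          rintro rfl
          apply hIij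
          apply Finset.eq_of_subset_of_card_le
          · intro z hz
            rcases Finset.mem_insert.1 hz with rfl | hz
            · exact hiI
            · rwa [Finset.mem_singleton.1 hz]
          · rw [hIcard, Finset.card_pair hij]
        rw [meet i hiI hi j' hj' hne (hx j' hne.symm hjj'), zero_mul]
      · by_cases hjI : j ∈ I
        · obtain ⟨j', hj', hne⟩ := other j hjI
          have hij' : j' ≠ i := by rintro rfl; exact hiI hj'
          rw [meet j hjI hj j' hj' hne (hx j' hij' hne.symm), zero_mul]
        · have hc : (univ \ I).card = 3 := by
            rw [Finset.card_sdiff_of_subset (Finset.subset_univ _), hIcard]; rfl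
          obtain ⟨m, hm, hmne⟩ : ∃ m ∈ univ \ I, m ∉ ({i, j} : Finset (Fin 5)) := by
            by_contra! h
            have := Finset.card_le_card (show univ \ I ⊆ {i, j} from h)
            rw [hc, Finset.card_pair hij] at this
            omega
          simp only [Finset.mem_insert, Finset.mem_singleton, not_or] at hmne
          have huniv : univ \ I ⊆ {m, i, j} := by
            refine (Finset.eq_of_subset_of_card_le (s := {m, i, j}) (t := univ \ I) ?_ ?_).ge
            · intro z hz
              simp only [Finset.mem_insert, Finset.mem_singleton] at hz
              rcases hz with rfl | rfl | rfl
              · exact hm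
              · simpa using hiI
              · simpa using hjI
            · rw [hc, Finset.card_insert_of_notMem (by simp [hmne]), Finset.card_pair hij]
          obtain ⟨w, hw⟩ := hi
          obtain ⟨w', hw'⟩ := hj
          have h1 := hx m hmne.1 hmne.2
            (Sum.inr (Sum.inr (Sum.inl (π, k, m, fun z => if z = i then w else w'))))
          simp only [l, Sum.elim_inr, Sum.elim_inl] at h1
          rw [dif_pos (by rwa [hk]), MultilinearOn.slice_apply] at h1
          have h2 : γ π k x = 0 := by
            rw [← h1]
            refine (hγ π k).1 _ _ fun z hz => ?_
            rw [hk] at hz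
            have hz' := huniv hz
            simp only [Finset.mem_insert, Finset.mem_singleton] at hz'
            rcases hz' with rfl | rfl | rfl
            · simp
            · simp [Ne.symm hmne.1, hw]
            · simp [Ne.symm hmne.2, hij.symm, hw']
          rw [h2, mul_zero]

end Separation

section Descend

variable {n : ℕ}

theorem splitRank_component {V : Type*} [AddCommGroup V] [Module (ZMod 2) V] {r : ℕ}
    {J : Fin r → Finset (Fin 5)} {β γ : Fin r → (Fin 5 → V) → ZMod 2}
    (hβ : ∀ k, MultilinearOn 5 (J k) (β k)) (hγ : ∀ k, MultilinearOn 5 (univ \ J k) (γ k))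
    (I : Finset (Fin 5)) : SplitRank I r (component J β γ I) := by
  refine ⟨fun k => if J k = I then β k else 0, fun k => if J k = I then γ k else 0,
    fun k => ?_, fun k => ?_, ?_⟩
  · dsimp only
    split_ifs with h
    · exact h ▸ hβ k
    · exact MultilinearOn.zero _
  · dsimp only
    split_ifs with h
    · exact h ▸ hγ k
    · exact MultilinearOn.zero _
  · refine Finset.sum_congr rfl fun k _ => ?_
    by_cases h : J k = I <;> simp [h]

theorem sum_indexPairs_map {M : Type*} [AddCommMonoid M] (g : Equiv.Perm (Fin 5))
    (f : Finset (Fin 5) → M) :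
    ∑ I ∈ indexPairs, f (I.map g.toEmbedding) = ∑ I ∈ indexPairs, f I := by
  refine Finset.sum_bij' (fun I _ => I.map g.toEmbedding) (fun I _ => I.map g.symm.toEmbedding)
    ?_ ?_ ?_ ?_ ?_
  · intro I hI
    simpa [indexPairs] using hI
  · intro I hI
    simpa [indexPairs] using hI
  · intro I _
    ext x
    simp
  · intro I _
    ext x
    simp
  · intro I _
    rfl

/-- Once the functionals separating the components vanish, a form whose symmetry defects are sums
of products split along pairs is close to a symmetric form. -/
theorem exists_symmetric_of_pairs {r : ℕ} (A : (Fin 5 → Fin n → ZMod 2) → ZMod 2)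
    (J : Equiv.Perm (Fin 5) → Fin r → Finset (Fin 5))
    (β γ : Equiv.Perm (Fin 5) → Fin r → (Fin 5 → Fin n → ZMod 2) → ZMod 2)
    (hβ : ∀ π k, MultilinearOn 5 (J π k) (β π k))
    (hγ : ∀ π k, MultilinearOn 5 (univ \ J π k) (γ π k))
    (hA : ∀ π, A + permForm 5 π A = ∑ I ∈ indexPairs, component (J π) (β π) (γ π) I) :
    ∃ (ι : Type) (_ : Fintype ι) (l : ι → (Fin n → ZMod 2) →ₗ[ZMod 2] ZMod 2),
      Fintype.card ι = separationBound r ∧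
      ∀ p : (Fin n → ZMod 2) →ₗ[ZMod 2] (Fin n → ZMod 2), (∀ i x, l i (p x) = 0) →
        ∃ ψ, PrankDecompOn 5 univ (30 * (5 * r)) ψ ∧ SymmetricForm 5 (pull p A + ψ) := by
  obtain ⟨ι, _, l, B, D, hcard, hD, hdiag, hclean⟩ := exists_cleanOn J β γ hβ hγ
  refine ⟨ι, inferInstance, l, hcard, fun p hp => ?_⟩
  set f : Equiv.Perm (Fin 5) → Finset (Fin 5) → (Fin 5 → Fin n → ZMod 2) → ZMod 2 :=
    fun π I => component (J π) (β π) (γ π) I with hf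
  have hsum : ∀ π x, ∑ I ∈ indexPairs, f π I x = A x + permForm 5 π A x := by
    intro π x
    have := congrFun (hA π) x
    simpa using this.symm
  have two : ∀ a : ZMod 2, a + a = 0 := CharTwo.add_self_eq_zero
  have cancel : ∀ a b c : ZMod 2, a + b + (a + c) + (c + b) = 0 := fun a b c => by
    linear_combination two a + two b + two c
  have hpair : ∀ I ∈ indexPairs, ∃ i j : Fin 5, i ≠ j ∧ I = {i, j} := fun I hI =>
    Finset.card_eq_two.1 (Finset.mem_powersetCard.1 hI).2
  have hpairs_map : ∀ (g : Equiv.Perm (Fin 5)), ∀ I ∈ indexPairs,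
      I.map g.toEmbedding ∈ indexPairs := by
    intro g I hI
    simpa [indexPairs] using hI
  have h01mem : ({0, 1} : Finset (Fin 5)) ∈ indexPairs := by decide
  refine exists_symmetric_of_cocycle (pull p A) r (fun π I => pull p (f π I)) ?_ ?_ ?_ ?_ ?_
  · intro π
    funext x
    have := hsum π (fun i => p (x i))
    simpa [pull, permForm] using this.symm
  · intro π I _
    exact (splitRank_component (hβ π) (hγ π) I).pull p
  · intro g h I hI
    funext x
    obtain ⟨i, j, hij, rfl⟩ := hpair I hI
    have key := CleanOn.eq_zero_of_sum (U := {y | ∀ i, l i y = 0}) hD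
      (h := fun I => (f (h * g) I + f g I) + permForm 5 g (f h (I.map g.toEmbedding)))
      (fun I hI => ((hclean _ I hI).add (hclean _ I hI)).add
        (CleanOn.permForm g (hclean h _ (hpairs_map g I hI)))) hij (fun m => p (x m))
      (fun m _ _ i => hp i _) (fun d _ d' _ => by
        simp only [Pi.add_apply, Finset.sum_add_distrib]
        rw [hsum, hsum]
        simp only [permForm]
        rw [sum_indexPairs_map g fun I => f h I _, hsum]
        simp only [permForm]
        exact cancel _ _ _)
    simp only [Pi.add_apply, permForm] at key
    simp only [Pi.add_apply, permForm, pull]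
    linear_combination key - two (f g {i, j} fun m => p (x m)) - two (f h _ _)
  · intro x hx
    obtain ⟨b, hb, e⟩ : ∃ b ∈ B, ∀ u v, f (Equiv.swap 0 1) {0, 1} (Function.update
        (Function.update (fun m => p (x m)) 0 u) 1 v) = b u v :=
      (hclean (Equiv.swap 0 1) _ h01mem).slice 0 1 (by decide) rfl (fun m => p (x m))
    have hsymm : ∀ u v, b u v = b v u := by
      intro u v
      have key := CleanOn.eq_zero_of_sum (U := {y | ∀ i, l i y = 0}) hD
        (h := fun I => f (Equiv.swap 0 1) I + permForm 5 (Equiv.swap 0 1)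
          (f (Equiv.swap 0 1) (I.map (Equiv.swap 0 1).toEmbedding)))
        (fun I hI => (hclean _ I hI).add
          (CleanOn.permForm _ (hclean _ _ (hpairs_map _ I hI)))) (by decide : (0 : Fin 5) ≠ 1)
        (Function.update (Function.update (fun m => p (x m)) 0 u) 1 v)
        (fun m h0 h1 i => by simpa [h0, h1] using hp i _) (fun d _ d' _ => by
          simp only [Pi.add_apply, Finset.sum_add_distrib]
          rw [hsum]
          simp only [permForm]
          rw [sum_indexPairs_map (Equiv.swap 0 1) fun I => f (Equiv.swap 0 1) I _, hsum]
          simp only [permForm, Equiv.symm_swap, Equiv.swap_apply_self]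
          rw [add_comm (A _)]
          exact two _)
      have hmap : ({0, 1} : Finset (Fin 5)).map (Equiv.swap 0 1).toEmbedding = {0, 1} := by decide
      simp only [Pi.add_apply, permForm, update_comp_perm, hmap] at key
      have hxs : (fun j => p (x ((Equiv.swap (0 : Fin 5) 1).symm j))) = fun j => p (x j) := by
        funext j
        rw [Equiv.symm_swap]
        fin_cases j <;> simp [hx, Equiv.swap_apply_def]
      rw [hxs, e, Equiv.swap_apply_left, Equiv.swap_apply_right,
        Function.update_comm (by decide : (1 : Fin 5) ≠ 0), e] at key
      linear_combination key - two (b v u)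
    have h := e (p (x 0)) (p (x 1))
    have hx0 : Function.update (Function.update (fun m => p (x m)) 0 (p (x 0))) 1 (p (x 1)) =
        fun m => p (x m) := by simp
    rw [hx0] at h
    rw [pull, h, ← hx]
    refine hdiag b hb hsymm _ fun i => hp i _
  · intro x hx
    refine CleanOn.eq_zero_of_sum (U := {y | ∀ i, l i y = 0}) hD (h := f (Equiv.swap 2 3))
      (fun I hI => hclean _ I hI) (by decide : (0 : Fin 5) ≠ 1) (fun m => p (x m))
      (fun m _ _ i => hp i _) fun d _ d' _ => ?_
    rw [hsum, permForm]
    have hy : ∀ y : Fin 5 → Fin n → ZMod 2, y 2 = y 3 →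
        (fun j => y ((Equiv.swap (2 : Fin 5) 3).symm j)) = y := by
      intro y h
      funext j
      rw [Equiv.symm_swap]
      fin_cases j <;> simp [h, Equiv.swap_apply_def]
    rw [hy _ (by simp [hx])]
    exact two _

end Descend

section FirstStage

variable {n : ℕ}

theorem PrankDecompOn.mono {V : Type*} [AddCommGroup V] [Module (ZMod 2) V] {m r : ℕ}
    {f : (Fin 5 → V) → ZMod 2} (h : PrankDecompOn 5 univ m f) (hmr : m ≤ r) :
    PrankDecompOn 5 univ r f := by
  have h0 : PrankDecompOn 5 univ (r - m) (0 : (Fin 5 → V) → ZMod 2) :=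
    prankDecompOn_iff.2 ⟨fun _ => {0}, fun _ => 0, fun _ => 0, fun _ => by simp,
      fun _ => (by decide : ({0} : Finset (Fin 5)) ≠ univ), fun _ => MultilinearOn.zero _,
      fun _ => MultilinearOn.zero _, by simp⟩
  simpa [Nat.add_sub_cancel' hmr] using h.add h0

/-- Among five variables, each product may be taken to be split along at most two of them. -/
theorem PrankDecompOn.exists_card_le_two {V : Type*} [AddCommGroup V] [Module (ZMod 2) V] {r : ℕ}
    {f : (Fin 5 → V) → ZMod 2} (h : PrankDecompOn 5 univ r f) :
    ∃ (J : Fin r → Finset (Fin 5)) (β γ : Fin r → (Fin 5 → V) → ZMod 2),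
      (∀ k, (J k).card = 1 ∨ (J k).card = 2) ∧ (∀ k, MultilinearOn 5 (J k) (β k)) ∧
      (∀ k, MultilinearOn 5 (univ \ J k) (γ k)) ∧ f = ∑ k, β k * γ k := by
  obtain ⟨I, β, γ, h0, h1, hβ, hγ, rfl⟩ := prankDecompOn_iff.1 h
  have hcard : ∀ I : Finset (Fin 5), I ≠ ∅ → I ≠ univ →
      (I.card = 1 ∨ I.card = 2) ∨ ((univ \ I).card = 1 ∨ (univ \ I).card = 2) := by decide
  have key : ∀ k, ∃ (J : Finset (Fin 5)) (b c : (Fin 5 → V) → ZMod 2),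
      (J.card = 1 ∨ J.card = 2) ∧ MultilinearOn 5 J b ∧ MultilinearOn 5 (univ \ J) c ∧
      β k * γ k = b * c := by
    intro k
    rcases hcard (I k) (h0 k) (h1 k) with h | h
    · exact ⟨I k, β k, γ k, h, hβ k, hγ k, rfl⟩
    · refine ⟨univ \ I k, γ k, β k, h, hγ k, ?_, mul_comm _ _⟩
      simpa using hβ k
  choose J b c hJ hb hc e using key
  exact ⟨J, b, c, hJ, hb, hc, Finset.sum_congr rfl fun k _ => e k⟩

theorem pull_sum {V ι : Type*} [AddCommGroup V] [Module (ZMod 2) V] {k : ℕ} (s : Finset ι)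
    (p : V →ₗ[ZMod 2] V) (f : ι → (Fin k → V) → ZMod 2) :
    pull p (∑ i ∈ s, f i) = ∑ i ∈ s, pull p (f i) := by
  funext x
  simp [pull]

/-- Restricting to the kernel of the linear factors leaves only products split along pairs. -/
theorem exists_pull_component {r : ℕ} (A : (Fin 5 → Fin n → ZMod 2) → ZMod 2)
    (h : ∀ π, PrankDecompOn 5 univ r (A + permForm 5 π A)) :
    ∃ (ι : Type) (_ : Fintype ι) (l : ι → (Fin n → ZMod 2) →ₗ[ZMod 2] ZMod 2),
      Fintype.card ι = 120 * (r * 5) ∧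
      ∀ p : (Fin n → ZMod 2) →ₗ[ZMod 2] (Fin n → ZMod 2), (∀ i x, l i (p x) = 0) →
        ∃ (J : Equiv.Perm (Fin 5) → Fin r → Finset (Fin 5))
          (β γ : Equiv.Perm (Fin 5) → Fin r → (Fin 5 → Fin n → ZMod 2) → ZMod 2),
          (∀ π k, MultilinearOn 5 (J π k) (β π k)) ∧
          (∀ π k, MultilinearOn 5 (univ \ J π k) (γ π k)) ∧
          ∀ π, pull p A + permForm 5 π (pull p A) =
            ∑ I ∈ indexPairs, component (J π) (β π) (γ π) I := by
  choose J β γ hJ hβ hγ e using fun π => (h π).exists_card_le_two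
  refine ⟨Equiv.Perm (Fin 5) × Fin r × Fin 5, inferInstance, fun q =>
    if hq : q.2.2 ∈ J q.1 q.2.1 then (hβ q.1 q.2.1).slice hq 0 else 0, ?_, fun p hp => ?_⟩
  · simp [Fintype.card_perm, Nat.factorial]
  refine ⟨J, fun π k => pull p (β π k), fun π k => pull p (γ π k), fun π k => (hβ π k).pull p,
    fun π k => (hγ π k).pull p, fun π => ?_⟩
  have e1 : pull p A + permForm 5 π (pull p A) = pull p (A + permForm 5 π A) := rfl
  rw [e1, e π, pull_sum]
  simp only [component]
  rw [Finset.sum_comm]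
  refine Finset.sum_congr rfl fun k _ => ?_
  rw [Finset.sum_ite_eq]
  split_ifs with hmem
  · rfl
  · have h1 : (J π k).card = 1 := (hJ π k).resolve_right fun h2 =>
      hmem (Finset.mem_powersetCard.2 ⟨Finset.subset_univ _, h2⟩)
    obtain ⟨i, hi⟩ := Finset.card_eq_one.1 h1
    funext x
    have h2 := hp (π, k, i) (x i)
    simp only at h2
    rw [dif_pos (by simp [hi]), MultilinearOn.slice_apply] at h2
    have h3 : β π k (fun i => p (x i)) = 0 := by
      rw [← h2]
      refine (hβ π k).1 _ _ fun m hm => ?_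
      rw [hi, Finset.mem_singleton] at hm
      rw [hm]
      simp
    simp [pull, h3]

theorem le_exp_iterate (r : ℕ) :
    ((5 * (120 * (r * 5)) + 5 * separationBound r + 30 * (5 * r) : ℕ) : ℝ) ≤
      Real.exp^[5] (18966 * (r : ℝ) ^ (18966 : ℝ)) := by
  have hr : (r : ℝ) ≤ (r : ℝ) ^ (18966 : ℝ) := by
    rcases Nat.eq_zero_or_pos r with rfl | h
    · simp
    · exact Real.self_le_rpow_of_one_le (by exact_mod_cast h) (by norm_num)
  have hE : (1 : ℝ) ≤ 2 ^ (120 * (r * 25)) := one_le_pow₀ (by norm_num)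
  have hexp : (2 : ℝ) ^ (120 * (r * 25)) ≤ Real.exp (3000 * r) := by
    have h2 : (2 : ℝ) ≤ Real.exp 1 := by linarith [Real.add_one_le_exp (1 : ℝ)]
    calc (2 : ℝ) ^ (120 * (r * 25)) ≤ Real.exp 1 ^ (120 * (r * 25)) := by gcongr
      _ = Real.exp (3000 * r) := by
        rw [← Real.exp_nat_mul]
        push_cast
        ring_nf
  have h25 : (25 : ℝ) ≤ Real.exp 4 := by
    have h := Real.exp_one_gt_d9
    calc (25 : ℝ) ≤ 2.7 ^ 4 := by norm_num
      _ ≤ Real.exp 1 ^ 4 := by gcongr; linarith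
      _ = Real.exp 4 := by rw [← Real.exp_nat_mul]; norm_num
  have hlin : (25 : ℝ) + 99150 * r ≤ Real.exp (4 + 3966 * r) := by
    rw [Real.exp_add]
    have := Real.add_one_le_exp (3966 * (r : ℝ))
    nlinarith [Real.exp_pos 4, Nat.cast_nonneg (α := ℝ) r]
  have hup : ∀ x : ℝ, Real.exp (x + 4) ≤ Real.exp^[5] x := by
    intro x
    simp only [Function.iterate_succ, Function.iterate_zero, Function.comp, id]
    have h1 := Real.add_one_le_exp x
    have h2 := Real.add_one_le_exp (Real.exp x)
    have h3 := Real.add_one_le_exp (Real.exp (Real.exp x))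
    have h4 := Real.add_one_le_exp (Real.exp (Real.exp (Real.exp x)))
    exact Real.exp_le_exp.2 (by linarith)
  refine le_trans ?_ ((Real.exp_le_exp.2 (?_ : 15000 * (r : ℝ) + (4 + 3966 * r) ≤ _)).trans (hup _))
  · have h5 : ((2 : ℝ) ^ (120 * (r * 25))) ^ 5 ≤ Real.exp (15000 * r) := by
      calc ((2 : ℝ) ^ (120 * (r * 25))) ^ 5 ≤ Real.exp (3000 * r) ^ 5 := by gcongr
        _ = Real.exp (15000 * r) := by
          rw [← Real.exp_nat_mul]
          push_cast
          ring_nf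
    rw [Real.exp_add]
    refine le_trans ?_ (mul_le_mul h5 hlin (by positivity) (Real.exp_pos _).le)
    simp only [separationBound]
    push_cast
    generalize (2 : ℝ) ^ (120 * (r * 25)) = E at *
    have hr0 : (0 : ℝ) ≤ r := Nat.cast_nonneg r
    have e1 : E ≤ E ^ 5 := le_self_pow₀ hE (by norm_num)
    have e2 : E ^ 2 ≤ E ^ 5 := pow_le_pow_right₀ hE (by norm_num)
    have e3 : 1 * (r : ℝ) ≤ E ^ 5 * r := by
      gcongr
      exact one_le_pow₀ hE
    nlinarith
  · linarith

end FirstStage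

/-- **Corollary (Tidor's conjecture): approximately symmetric 5-variable forms are close
to symmetric forms.** There are `C ≥ 1` and `t ∈ ℕ` such that: if `α : G⁵ → 𝔽₂` is
multilinear and `prank(α + α∘π) ≤ r` for every `π ∈ Sym₅`, then some symmetric
multilinear form `α'` satisfies `prank(α + α') ≤ exp^{(t)}(C·r^C)`. -/
theorem statement5 :
    ∃ (C : ℝ) (t : ℕ), 1 ≤ C ∧
      ∀ (n : ℕ) (α : (Fin 5 → (Fin n → ZMod 2)) → ZMod 2), IsMultilinear 5 α →
        ∀ r : ℕ, (∀ π : Equiv.Perm (Fin 5), prank 5 (α + permForm 5 π α) ≤ r) →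
          ∃ α' : (Fin 5 → (Fin n → ZMod 2)) → ZMod 2,
            IsMultilinear 5 α' ∧ SymmetricForm 5 α' ∧
            (prank 5 (α + α') : ℝ) ≤ Real.exp^[t] (C * (r : ℝ) ^ C) := by
  refine ⟨18966, 5, by norm_num, fun n α hα r hr => ?_⟩
  have hdec : ∀ π, PrankDecompOn 5 univ r (α + permForm 5 π α) := fun π =>
    (prankDecompOn_prank (by norm_num) (hα.add (MultilinearOn.permForm π (by
      simpa [IsMultilinear] using hα)))).mono (hr π)
  obtain ⟨ι, _, l, hcard, hl⟩ := exists_pull_component α hdec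
  obtain ⟨p, e, hp, hlp⟩ := exists_projection l
  obtain ⟨J, β, γ, hβ, hγ, hA⟩ := hl p hlp
  obtain ⟨ι', _, l', hcard', hl'⟩ := exists_symmetric_of_pairs (pull p α) J β γ hβ hγ hA
  obtain ⟨p', e', hp', hlp'⟩ := exists_projection l'
  obtain ⟨ψ, hψ, hsymm⟩ := hl' p' hlp'
  have hα' : IsMultilinear 5 (pull p α) := MultilinearOn.pull hα p
  refine ⟨_, (MultilinearOn.pull hα' p').add hψ.isMultilinear, hsymm, ?_⟩
  have h1 := prankDecompOn_add_pull (by norm_num) hα p l e hp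
  have h2 := prankDecompOn_add_pull (by norm_num) hα' p' l' e' hp'
  have h3 := ((h1.add h2).add hψ).prank_le
  rw [hcard, hcard'] at h3
  have e3 : α + pull p α + (pull p α + pull p' (pull p α)) + ψ =
      α + (pull p' (pull p α) + ψ) := by
    rw [add_assoc α, ← add_assoc (pull p α), form_add_self, zero_add, add_assoc]
  rw [e3] at h3
  exact (Nat.cast_le.2 h3).trans (le_exp_iterate r)
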